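/- arXiv:2311.13705 — 7 statements merged into one kernel-verified Lean document; each statement's English description precedes it below -/
import Mathlib

section
/- Let y₁,…,y_k ∈ R satisfy y_m·y_n = y_n·y_m whenever |m−n| > 1 (an 'almost commuting' tuple). Define the right-nested iterated q-commutator P'_k recursively by P'₁(y₁) = y₁ and P'_{k+1}(y₁,…,y_{k+1}) = P'_k(y₁,…,y_{k−1}, [y_k, y_{k+1}]_q). Then P_k(y₁,…,y_k) = P'_k(y₁,…,y_k), i.e. the left-nested and right-nested iterated q-commutators of an almost commuting tuple coincide. -/
noncomputable section

/-- The `t`-commutator `[a,b]_t = a*b - t•(b*a)`. -/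
def qcomm {R : Type*} [Ring R] [Algebra ℂ R] (t : ℂ) (a b : R) : R :=
  a * b - t • (b * a)

/-- Left-nested iterated `q`-commutator:
`P (y₁,…,y_k) = [ … [[y₁,y₂]_q, y₃]_q …, y_k]_q`. -/
def PL {R : Type*} [Ring R] [Algebra ℂ R] (q : ℂ) : List R → R
  | [] => 1
  | y :: ys => ys.foldl (fun a b => qcomm q a b) y

/-- Right-nested iterated `q`-commutator:
`P' (y₁,…,y_k) = [y₁, [y₂, … [y_{k-1}, y_k]_q …]_q]_q`. -/
def PR {R : Type*} [Ring R] [Algebra ℂ R] (q : ℂ) : List R → R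
  | [] => 1
  | [y] => y
  | y :: a :: ys => qcomm q y (PR q (a :: ys))

theorem qcomm_assoc_of_commute {R : Type*} [Ring R] [Algebra ℂ R] (q : ℂ) {a c : R}
    (h : Commute a c) (b : R) : qcomm q (qcomm q a b) c = qcomm q a (qcomm q b c) := by
  have h₁ : a * (c * b) = c * (a * b) := by rw [← mul_assoc, h.eq, mul_assoc]
  have h₂ : b * a * c = b * c * a := by rw [mul_assoc, h.eq, mul_assoc]
  simp only [qcomm, sub_mul, mul_sub, smul_sub, smul_mul_assoc, mul_smul_comm, h₁, h₂]
  simp only [mul_assoc]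
  abel

theorem foldl_qcomm_of_commute {R : Type*} [Ring R] [Algebra ℂ R] (q : ℂ) {x : R} {l : List R}
    (h : ∀ c ∈ l, Commute x c) (a : R) :
    l.foldl (qcomm q) (qcomm q x a) = qcomm q x (l.foldl (qcomm q) a) := by
  induction l generalizing a with
  | nil => rfl
  | cons c l ih =>
    rw [List.foldl_cons, List.foldl_cons, qcomm_assoc_of_commute q (h c List.mem_cons_self),
      ih fun d hd => h d (List.mem_cons_of_mem c hd)]

theorem PL_cons_cons_of_commute {R : Type*} [Ring R] [Algebra ℂ R] (q : ℂ) {x : R} {l : List R}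
    (h : ∀ c ∈ l, Commute x c) (a : R) :
    PL q (x :: a :: l) = qcomm q x (PL q (a :: l)) :=
  foldl_qcomm_of_commute q h a

/-- For an almost commuting tuple, the left-nested and right-nested iterated
`q`-commutators coincide. -/
theorem PL_eq_PR_of_almost_commuting {R : Type*} [Ring R] [Algebra ℂ R]
    (q : ℂ) (hq : q ≠ 0) (k : ℕ) (hk : 1 ≤ k) (y : Fin k → R)
    (hcomm : ∀ m n : Fin k, (m : ℕ) + 1 < (n : ℕ) → y m * y n = y n * y m) :
    PL q (List.ofFn y) = PR q (List.ofFn y) := by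
  induction k, hk using Nat.le_induction with
  | base => simp [PL, PR]
  | succ k hk ih =>
    obtain ⟨k, rfl⟩ := Nat.exists_eq_add_of_le' hk
    have htail := ih (fun i => y i.succ) fun m n hmn => hcomm _ _ (by simpa using hmn)
    rw [List.ofFn_succ] at htail
    rw [List.ofFn_succ, List.ofFn_succ, PL_cons_cons_of_commute q, PR, htail]
    intro c hc
    obtain ⟨i, rfl⟩ := (List.mem_ofFn' _ _).1 hc
    exact hcomm _ _ (by simp)
end
end

section
/- Let k ≥ 2 and let y₁,…,y_k, c ∈ R be such that c commutes with each of y₁,…,y_{k−1} (i.e. y_j·c = c·y_j for 1 ≤ j ≤ k−1). Then [P_k(y₁,…,y_k), c]_q = [P_{k−1}(y₁,…,y_{k−1}), [y_k, c]_q]_q. -/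
noncomputable section

theorem Commute.qcomm_left {R : Type*} [Ring R] [Algebra ℂ R] {t : ℂ} {a b c : R}
    (ha : Commute a c) (hb : Commute b c) : Commute (qcomm t a b) c :=
  (ha.mul_left hb).sub_left ((hb.mul_left ha).smul_left t)

theorem Commute.foldl_qcomm_left {R : Type*} [Ring R] [Algebra ℂ R] {t : ℂ} {c : R}
    (l : List R) {a : R} (ha : Commute a c) (hl : ∀ x ∈ l, Commute x c) :
    Commute (l.foldl (fun a b => qcomm t a b) a) c := by
  induction l generalizing a with
  | nil => exact ha
  | cons b l ih =>
    exact ih (ha.qcomm_left (hl b (by simp))) fun x hx => hl x (by simp [hx])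

theorem Commute.PL_left {R : Type*} [Ring R] [Algebra ℂ R] {t : ℂ} {c : R}
    {l : List R} (hl : ∀ x ∈ l, Commute x c) : Commute (PL t l) c := by
  cases l with
  | nil => exact Commute.one_left c
  | cons a l =>
    exact Commute.foldl_qcomm_left l (hl a (by simp)) fun x hx => hl x (by simp [hx])

theorem PL_concat {R : Type*} [Ring R] [Algebra ℂ R] (t : ℂ) {l : List R} (hl : l ≠ [])
    (b : R) : PL t (l.concat b) = qcomm t (PL t l) b := by
  cases l with
  | nil => exact absurd rfl hl
  | cons a l => simp [PL]

theorem qcomm_qcomm_of_commute {R : Type*} [Ring R] [Algebra ℂ R] (t : ℂ) {a c : R}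
    (h : Commute a c) (b : R) : qcomm t (qcomm t a b) c = qcomm t a (qcomm t b c) := by
  have hac : a * (c * b) = c * (a * b) := by rw [← mul_assoc, h.eq, mul_assoc]
  simp only [qcomm, mul_sub, sub_mul, smul_sub, mul_smul_comm, smul_mul_assoc, mul_assoc,
    h.eq, hac]
  abel

/-- If `c` commutes with all but the last entry `y₁,…,y_{k-1}` of a tuple
`y₁,…,y_k` (here `k = n + 2 ≥ 2`), then
`[P_k(y₁,…,y_k), c]_q = [P_{k-1}(y₁,…,y_{k-1}), [y_k, c]_q]_q`. -/
theorem qcomm_PL_of_commutes {R : Type*} [Ring R] [Algebra ℂ R]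
    (q : ℂ) (hq : q ≠ 0) (n : ℕ) (y : Fin (n + 2) → R) (c : R)
    (hc : ∀ j : Fin (n + 1), y j.castSucc * c = c * y j.castSucc) :
    qcomm q (PL q (List.ofFn y)) c =
      qcomm q (PL q (List.ofFn fun j : Fin (n + 1) => y j.castSucc))
        (qcomm q (y (Fin.last (n + 1))) c) := by
  rw [List.ofFn_succ_last (f := y) |>.trans (List.concat_eq_append ..).symm,
    PL_concat q (by simp)]
  refine qcomm_qcomm_of_commute q (Commute.PL_left fun x hx => ?_) _
  obtain ⟨j, rfl⟩ := List.mem_ofFn.mp hx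
  exact hc j
end
end

section
/- Let a, b, f, y ∈ R satisfy f·a = q·(a·f), f·b = q·(b·f), and y·f = f·y. Then [[a, [b, y]_q]_q, f]_{q⁻²} = 0. -/
noncomputable section

theorem mul_mul_eq_smul {R : Type*} [Ring R] [Algebra ℂ R] {s t : ℂ} {f x y : R}
    (hx : f * x = s • (x * f)) (hy : f * y = t • (y * f)) :
    f * (x * y) = (s * t) • (x * y * f) := by
  rw [← mul_assoc, hx, smul_mul_assoc, mul_assoc, hy, mul_smul_comm, smul_smul, mul_assoc]

theorem mul_qcomm_eq_smul {R : Type*} [Ring R] [Algebra ℂ R] (r : ℂ) {s t : ℂ} {f x y : R}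
    (hx : f * x = s • (x * f)) (hy : f * y = t • (y * f)) :
    f * qcomm r x y = (s * t) • (qcomm r x y * f) := by
  rw [qcomm, mul_sub, sub_mul, smul_sub, mul_smul_comm, smul_mul_assoc,
    mul_mul_eq_smul hx hy, mul_mul_eq_smul hy hx, mul_comm t s, smul_comm r]

/-- If `f·a = q·(a·f)`, `f·b = q·(b·f)` and `y` commutes with `f`, then
`[[a, [b, y]_q]_q, f]_{q⁻²} = 0`. -/
theorem qcomm_qcomm_qcomm_eq_zero {R : Type*} [Ring R] [Algebra ℂ R]
    (q : ℂ) (hq : q ≠ 0) (a b f y : R)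
    (hfa : f * a = q • (a * f)) (hfb : f * b = q • (b * f))
    (hyf : y * f = f * y) :
    qcomm ((q ^ 2)⁻¹) (qcomm q a (qcomm q b y)) f = 0 := by
  have hfy : f * y = (1 : ℂ) • (y * f) := by rw [one_smul, hyf]
  have h := mul_qcomm_eq_smul q hfa (mul_qcomm_eq_smul q hfb hfy)
  rw [mul_one, ← sq] at h
  rw [qcomm, h, inv_smul_smul₀ (pow_ne_zero 2 hq), sub_self]
end
end

section
/- Let φ : ℕ → R and x : ℤ → R be families of elements of R satisfying: (i) x_k·φ₀ = q²·(φ₀·x_k) for all k ∈ ℤ; and (ii) φ_r·x_s + x_{s−1}·φ_{r−1} = q⁻²·(x_s·φ_r + φ_{r−1}·x_{s−1}) for all integers r ≥ 1 and all s ∈ ℤ. Then for all k ∈ ℤ and r ∈ ℕ: x_k·φ_r = q²·(φ_r·x_k) + (q⁴−1)·Σ_{s=1}^{r} q^{2(s−1)}·φ_{r−s}·x_{k−s}. -/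
noncomputable section

/-- Paper's Lemma 4.1: the commutation formula
`x_k·φ_r = q²·(φ_r·x_k) + (q⁴−1)·Σ_{s=1}^{r} q^{2(s−1)}·φ_{r−s}·x_{k−s}`,
deduced from the basic relations (i) and (ii). -/
theorem x_phi_commutation {R : Type*} [Ring R] [Algebra ℂ R]
    (q : ℂ) (hq : q ≠ 0) (φ : ℕ → R) (x : ℤ → R)
    (h1 : ∀ k : ℤ, x k * φ 0 = (q ^ 2) • (φ 0 * x k))
    (h2 : ∀ r : ℕ, 1 ≤ r → ∀ s : ℤ,
      φ r * x s + x (s - 1) * φ (r - 1) =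
        (q ^ 2)⁻¹ • (x s * φ r + φ (r - 1) * x (s - 1))) :
    ∀ (k : ℤ) (r : ℕ),
      x k * φ r = (q ^ 2) • (φ r * x k) +
        (q ^ 4 - 1) • ∑ s ∈ Finset.Icc 1 r,
          (q ^ (2 * (s - 1))) • (φ (r - s) * x (k - (s : ℤ))) := by
  intro k r
  simp only [← Finset.Ico_add_one_right_eq_Icc, Finset.sum_Ico_eq_sum_range,
    Nat.add_sub_cancel, Nat.add_sub_cancel_left]
  induction r generalizing k with
  | zero => simpa using h1 k
  | succ r ih =>
    have hstep : x k * φ (r + 1) = (q ^ 2) • (φ (r + 1) * x k) +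
        (q ^ 2) • (x (k - 1) * φ r) - φ r * x (k - 1) := by
      have h := congrArg (fun y => (q ^ 2) • y) (h2 (r + 1) (by omega) k)
      simp only [Nat.add_sub_cancel, smul_inv_smul₀ (pow_ne_zero 2 hq), smul_add] at h
      rw [h, add_sub_cancel_right]
    have hsum : ∑ s ∈ Finset.range r,
        q ^ (2 * (s + 1)) • (φ (r + 1 - (1 + (s + 1))) * x (k - ((1 + (s + 1) : ℕ) : ℤ))) =
        (q ^ 2) • ∑ s ∈ Finset.range r,
          q ^ (2 * s) • (φ (r - (1 + s)) * x (k - 1 - ((1 + s : ℕ) : ℤ))) := by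
      rw [Finset.smul_sum]
      refine Finset.sum_congr rfl fun s _ => ?_
      rw [smul_smul, show r + 1 - (1 + (s + 1)) = r - (1 + s) by omega,
        show k - ((1 + (s + 1) : ℕ) : ℤ) = k - 1 - ((1 + s : ℕ) : ℤ) by push_cast; ring]
      congr 1
      ring
    rw [hstep, ih (k - 1), Finset.sum_range_succ', hsum]
    simp only [mul_zero, pow_zero, one_smul, add_zero, Nat.add_sub_cancel, Nat.cast_one]
    module
end
end

section
/- Let q, C, γ_Q, γ_R ∈ ℂ be nonzero, and let Q, R, Q*, R* ∈ ℂ[z] be polynomials with constant term 1 such that Q(z) = γ_Q·z^{deg Q}·Q*(z⁻¹) and R(z) = γ_R·z^{deg R}·R*(z⁻¹) hold in ℂ(z). Define 𝐝 = q^{deg Q − deg R}·(Q(q⁻¹z)·R(qz))/(Q(qz)·R(q⁻¹z)) ∈ ℂ(z), and the polynomials 𝒬(z) = Q(Cz)·R*(z) and 𝒬†(z) = R(Cz)·Q*(z). Then the following identity holds in ℂ(z): 𝐝(Cz)·𝐝(z⁻¹) = (𝒬(q⁻¹z)/𝒬(qz))·(𝒬†(qz)/𝒬†(q⁻¹z)).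 -/
open Polynomial

noncomputable section

/-- Two `ℂ`-algebra homomorphisms out of `ℂ(z)` which agree on `z` agree on polynomials. -/
theorem RatFunc.algHom_apply_algebraMap_congr {K A : Type*} [Field K] [Semiring A] [Algebra K A]
    {f g : RatFunc K →ₐ[K] A} (h : f RatFunc.X = g RatFunc.X) (P : K[X]) :
    f (algebraMap K[X] (RatFunc K) P) = g (algebraMap K[X] (RatFunc K) P) := by
  have key : f.comp (IsScalarTower.toAlgHom K K[X] (RatFunc K)) =
      g.comp (IsScalarTower.toAlgHom K K[X] (RatFunc K)) := by
    apply Polynomial.algHom_ext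
    simpa using h
  exact DFunLike.congr_fun key P

/-- A `K`-algebra endomorphism of `K(z)` fixes constants. -/
theorem RatFunc.algHom_apply_C {K : Type*} [Field K] (f : RatFunc K →ₐ[K] RatFunc K) (c : K) :
    f (RatFunc.C c) = RatFunc.C c := by
  rw [← RatFunc.algebraMap_eq_C]
  exact f.commutes c

/-- Frenkel–Reshetikhin-type identity: with
`d = q^{deg Q − deg R}·(Q(q⁻¹z)·R(qz))/(Q(qz)·R(q⁻¹z))`,
`𝒬(z) = Q(Cz)·R*(z)` and `𝒬†(z) = R(Cz)·Q*(z)`, one has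
`d(Cz)·d(z⁻¹) = (𝒬(q⁻¹z)/𝒬(qz))·(𝒬†(qz)/𝒬†(q⁻¹z))` in `ℂ(z)`.
Substitutions `z ↦ w` are encoded as ℂ-algebra homomorphisms of `RatFunc ℂ`
sending `X` to `w` (such a homomorphism is unique). -/
theorem frenkel_reshetikhin_type_identity
    (q C γQ γR : ℂ) (hq : q ≠ 0) (hC : C ≠ 0) (hγQ : γQ ≠ 0) (hγR : γR ≠ 0)
    (Q R Qs Rs : ℂ[X])
    (hQ0 : Q.coeff 0 = 1) (hR0 : R.coeff 0 = 1)
    (hQs0 : Qs.coeff 0 = 1) (hRs0 : Rs.coeff 0 = 1)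
    (σq σq' σC σinv : RatFunc ℂ →ₐ[ℂ] RatFunc ℂ)
    (hσq : σq RatFunc.X = RatFunc.C q * RatFunc.X)
    (hσq' : σq' RatFunc.X = (RatFunc.C q)⁻¹ * RatFunc.X)
    (hσC : σC RatFunc.X = RatFunc.C C * RatFunc.X)
    (hσinv : σinv RatFunc.X = RatFunc.X⁻¹)
    (hQrel : algebraMap ℂ[X] (RatFunc ℂ) Q =
      RatFunc.C γQ * RatFunc.X ^ Q.natDegree * σinv (algebraMap ℂ[X] (RatFunc ℂ) Qs))
    (hRrel : algebraMap ℂ[X] (RatFunc ℂ) R =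
      RatFunc.C γR * RatFunc.X ^ R.natDegree * σinv (algebraMap ℂ[X] (RatFunc ℂ) Rs))
    (dd Qcal Qdag : RatFunc ℂ)
    (hdd : dd = RatFunc.C (q ^ ((Q.natDegree : ℤ) - (R.natDegree : ℤ))) *
      (σq' (algebraMap ℂ[X] (RatFunc ℂ) Q) * σq (algebraMap ℂ[X] (RatFunc ℂ) R)) /
      (σq (algebraMap ℂ[X] (RatFunc ℂ) Q) * σq' (algebraMap ℂ[X] (RatFunc ℂ) R)))
    (hQcal : Qcal = σC (algebraMap ℂ[X] (RatFunc ℂ) Q) * algebraMap ℂ[X] (RatFunc ℂ) Rs)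
    (hQdag : Qdag = σC (algebraMap ℂ[X] (RatFunc ℂ) R) * algebraMap ℂ[X] (RatFunc ℂ) Qs) :
    σC dd * σinv dd = (σq' Qcal / σq Qcal) * (σq Qdag / σq' Qdag) := by
  have cC := fun f : RatFunc ℂ →ₐ[ℂ] RatFunc ℂ => RatFunc.algHom_apply_C f
  have ne : ∀ P : ℂ[X], P.coeff 0 = 1 → algebraMap ℂ[X] (RatFunc ℂ) P ≠ 0 := by
    intro P hP h
    rw [map_eq_zero_iff _ (RatFunc.algebraMap_injective ℂ)] at h
    simp [h] at hP
  have nef : ∀ (f : RatFunc ℂ →ₐ[ℂ] RatFunc ℂ) {x : RatFunc ℂ}, x ≠ 0 → f x ≠ 0 :=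
    fun f _ hx => (_root_.map_ne_zero f).2 hx
  have X0 : (RatFunc.X : RatFunc ℂ) ≠ 0 := RatFunc.X_ne_zero
  have q0 : (RatFunc.C q : RatFunc ℂ) ≠ 0 := (_root_.map_ne_zero _).2 hq
  have gQ0 : (RatFunc.C γQ : RatFunc ℂ) ≠ 0 := (_root_.map_ne_zero _).2 hγQ
  have gR0 : (RatFunc.C γR : RatFunc ℂ) ≠ 0 := (_root_.map_ne_zero _).2 hγR
  have inv_q (P : ℂ[X]) : σinv (σq (algebraMap _ _ P)) = σq' (σinv (algebraMap _ _ P)) :=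
    RatFunc.algHom_apply_algebraMap_congr (f := σinv.comp σq) (g := σq'.comp σinv)
      (by simp [hσq, hσq', hσinv, cC, mul_comm]) P
  have inv_q' (P : ℂ[X]) : σinv (σq' (algebraMap _ _ P)) = σq (σinv (algebraMap _ _ P)) :=
    RatFunc.algHom_apply_algebraMap_congr (f := σinv.comp σq') (g := σq.comp σinv)
      (by simp [hσq, hσq', hσinv, cC, mul_comm]) P
  have C_q (P : ℂ[X]) : σC (σq (algebraMap _ _ P)) = σq (σC (algebraMap _ _ P)) :=
    RatFunc.algHom_apply_algebraMap_congr (f := σC.comp σq) (g := σq.comp σC)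
      (by simp [hσq, hσC, cC]; ring) P
  have C_q' (P : ℂ[X]) : σC (σq' (algebraMap _ _ P)) = σq' (σC (algebraMap _ _ P)) :=
    RatFunc.algHom_apply_algebraMap_congr (f := σC.comp σq') (g := σq'.comp σC)
      (by simp [hσq', hσC, cC]; ring) P
  have inv_invol (P : ℂ[X]) : σinv (σinv (algebraMap _ _ P)) = algebraMap _ _ P :=
    RatFunc.algHom_apply_algebraMap_congr (f := σinv.comp σinv) (g := AlgHom.id ℂ _)
      (by simp [hσinv]) P
  have invQ : σinv (algebraMap _ _ Q) = RatFunc.C γQ * (RatFunc.X⁻¹) ^ Q.natDegree *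
      algebraMap _ _ Qs := by
    rw [hQrel, map_mul, map_mul, map_pow, inv_invol, hσinv, cC]
  have invR : σinv (algebraMap _ _ R) = RatFunc.C γR * (RatFunc.X⁻¹) ^ R.natDegree *
      algebraMap _ _ Rs := by
    rw [hRrel, map_mul, map_mul, map_pow, inv_invol, hσinv, cC]
  have hQ := ne Q hQ0
  have hR := ne R hR0
  have hQs := ne Qs hQs0
  have hRs := ne Rs hRs0
  clear hQrel hRrel
  subst hdd hQcal hQdag
  simp only [map_mul, map_div₀, inv_q, inv_q', C_q, C_q', invQ, invR, map_pow, map_inv₀, cC,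
    hσq, hσq', zpow_sub₀ hq, zpow_natCast, mul_inv, mul_pow, inv_pow, inv_inv]
  have h1 := nef σq (nef σC hQ)
  have h2 := nef σq' (nef σC hQ)
  have h3 := nef σq (nef σC hR)
  have h4 := nef σq' (nef σC hR)
  have h5 := nef σq hQs
  have h6 := nef σq' hQs
  have h7 := nef σq hRs
  have h8 := nef σq' hRs
  field_simp
end
end

section
/- Let q, c₀, c₁ ∈ ℂ be nonzero and s₀, s₁ ∈ ℂ. Set C = q⁴·c₀·c₁, α = C·(q⁻²·c₀⁻¹·s₀)² + s₁², β = q⁻²·c₀⁻¹·s₀·s₁, and define the rational function D = (q⁻¹·(q−q⁻¹)²·c₁⁻¹·C·(α·z + β·(1+C·z²))·z + (1−C·z²)²)/(1−C·z²)² ∈ ℂ(z). Then there exists a rational function F ∈ ℂ(z) such that D·F·σ(F) = 1, where σ is the unique ℂ-algebra field automorphism of ℂ(z) with σ(z) = C⁻¹·z⁻¹; equivalently, D(z) = (F(z)·F(C⁻¹z⁻¹))⁻¹. -/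
noncomputable section

/-- Two complex numbers with prescribed sum and product always exist. -/
theorem exists_add_eq_and_mul_eq (a b : ℂ) : ∃ r t : ℂ, r + t = a ∧ r * t = b := by
  obtain ⟨d, hd⟩ := IsAlgClosed.exists_eq_mul_self (a ^ 2 - 4 * b)
  refine ⟨(a + d) / 2, (a - d) / 2, by ring, ?_⟩
  linear_combination hd / 4

/-- If `σ` sends `X` to `(C X)⁻¹`, then every translate of the `σ`-invariant function
`C X + X⁻¹` by a constant is of the form `G * σ G`. -/
theorem exists_ne_zero_mul_map_eq_sub_C {C : ℂ} (hC : C ≠ 0) (σ : RatFunc ℂ →ₐ[ℂ] RatFunc ℂ)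
    (hσ : σ RatFunc.X = (RatFunc.C C)⁻¹ * RatFunc.X⁻¹) (a : ℂ) :
    ∃ G : RatFunc ℂ, G ≠ 0 ∧ σ G ≠ 0 ∧
      G * σ G = RatFunc.C C * RatFunc.X + RatFunc.X⁻¹ - RatFunc.C a := by
  obtain ⟨r, t, hrt, hprod⟩ := exists_add_eq_and_mul_eq a C
  obtain ⟨k, hk⟩ := IsAlgClosed.exists_eq_mul_self (-t)
  have hr : r ≠ 0 := by rintro rfl; simp_all
  have ht : t ≠ 0 := by rintro rfl; simp_all
  have hk0 : k ≠ 0 := by rintro rfl; simp_all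
  have hX : (RatFunc.X : RatFunc ℂ) ≠ 0 := RatFunc.X_ne_zero
  have hσC (x : ℂ) : σ (RatFunc.C x) = RatFunc.C x := by
    rw [← RatFunc.algebraMap_eq_C]; exact σ.commutes x
  have hC_ne {x : ℂ} (hx : x ≠ 0) : RatFunc.C x ≠ 0 := by simpa using hx
  have hG : RatFunc.C k * (1 - RatFunc.C r * RatFunc.X) ≠ 0 := by
    refine mul_ne_zero (hC_ne hk0) fun h => ?_
    have h' : (1 - Polynomial.C r * Polynomial.X : Polynomial ℂ) = 0 := by
      apply RatFunc.algebraMap_injective ℂ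
      simpa using h
    simpa using congrArg (Polynomial.eval 0) h'
  refine ⟨_, hG, (map_ne_zero σ).2 hG, ?_⟩
  have hk' : -RatFunc.C t = RatFunc.C k * RatFunc.C k := by rw [← map_neg, hk, map_mul]
  have hr' := hC_ne hr
  have ht' := hC_ne ht
  simp only [map_mul, map_sub, map_one, hσC, hσ, ← hrt, ← hprod, map_add]
  calc
    _ = (RatFunc.C k * RatFunc.C k) * ((1 - RatFunc.C r * RatFunc.X) *
        (1 - RatFunc.C r * ((RatFunc.C r * RatFunc.C t)⁻¹ * RatFunc.X⁻¹))) := by ring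
    _ = _ := by
      rw [← hk']
      field_simp
      ring

/-- The eigenvalue series `Đ_{c,s}(z)` of the normalized Drinfeld–Cartan series on the
one-dimensional representation `ℂ_{c,s}` factorizes as
`D(z) = (F(z)·F(C⁻¹z⁻¹))⁻¹` for some rational function `F`. The substitution
`z ↦ C⁻¹z⁻¹` is encoded as a ℂ-algebra homomorphism `σ` of `RatFunc ℂ` with
`σ(X) = C⁻¹X⁻¹` (such a homomorphism is unique). -/
theorem one_dimensional_eigenvalue_factorization
    (q c₀ c₁ : ℂ) (hq : q ≠ 0) (hc₀ : c₀ ≠ 0) (hc₁ : c₁ ≠ 0) (s₀ s₁ : ℂ)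
    (C α β : ℂ)
    (hC : C = q ^ 4 * c₀ * c₁)
    (hα : α = C * ((q ^ 2)⁻¹ * c₀⁻¹ * s₀) ^ 2 + s₁ ^ 2)
    (hβ : β = (q ^ 2)⁻¹ * c₀⁻¹ * s₀ * s₁)
    (D : RatFunc ℂ)
    (hD : D = (RatFunc.C (q⁻¹ * (q - q⁻¹) ^ 2 * c₁⁻¹ * C) *
        (RatFunc.C α * RatFunc.X +
          RatFunc.C β * (1 + RatFunc.C C * RatFunc.X ^ 2)) * RatFunc.X +
        (1 - RatFunc.C C * RatFunc.X ^ 2) ^ 2) /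
      (1 - RatFunc.C C * RatFunc.X ^ 2) ^ 2)
    (σ : RatFunc ℂ →ₐ[ℂ] RatFunc ℂ)
    (hσ : σ RatFunc.X = (RatFunc.C C)⁻¹ * RatFunc.X⁻¹) :
    ∃ F : RatFunc ℂ, D * (F * σ F) = 1 := by
  have hC0 : C ≠ 0 := by rw [hC]; positivity
  have hX : (RatFunc.X : RatFunc ℂ) ≠ 0 := RatFunc.X_ne_zero
  generalize q⁻¹ * (q - q⁻¹) ^ 2 * c₁⁻¹ * C = κ at hD
  obtain ⟨a, b, hab, hab'⟩ := exists_add_eq_and_mul_eq (-(κ * β)) (κ * α - 4 * C)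
  obtain ⟨d, hd⟩ := IsAlgClosed.exists_eq_mul_self (4 * C)
  have key := exists_ne_zero_mul_map_eq_sub_C hC0 σ hσ
  obtain ⟨A, hA, hσA, hA'⟩ := key a
  obtain ⟨B, hB, hσB, hB'⟩ := key b
  obtain ⟨E, hE, hσE, hE'⟩ := key d
  obtain ⟨G, hG, hσG, hG'⟩ := key (-d)
  have hab := congrArg RatFunc.C hab
  have hab' := congrArg RatFunc.C hab'
  have hd := congrArg RatFunc.C hd
  simp only [map_add, map_mul, map_neg, map_sub, map_ofNat] at hab hab' hd hG'
  have hnum : RatFunc.C κ * (RatFunc.C α * RatFunc.X +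
      RatFunc.C β * (1 + RatFunc.C C * RatFunc.X ^ 2)) * RatFunc.X +
      (1 - RatFunc.C C * RatFunc.X ^ 2) ^ 2 =
      RatFunc.X ^ 2 * ((A * σ A) * (B * σ B)) := by
    rw [hA', hB']
    field_simp
    linear_combination (RatFunc.X + RatFunc.C C * RatFunc.X ^ 3) * hab - RatFunc.X ^ 2 * hab'
  have hden : (1 - RatFunc.C C * RatFunc.X ^ 2) ^ 2 =
      RatFunc.X ^ 2 * ((E * σ E) * (G * σ G)) := by
    rw [hE', hG']
    field_simp
    linear_combination -RatFunc.X ^ 2 * hd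
  refine ⟨E * G / (A * B), ?_⟩
  rw [hD, hnum, hden]
  simp only [map_div₀, map_mul]
  field_simp
end
end

section
/- Let q, c₀, c₁ ∈ ℂ be nonzero with q² ≠ 1, and s₀, s₁ ∈ ℂ. Set C = q⁴·c₀·c₁, α = C·(q⁻²·c₀⁻¹·s₀)² + s₁², β = q⁻²·c₀⁻¹·s₀·s₁, and define D = (q⁻¹·(q−q⁻¹)²·c₁⁻¹·C·(α·z + β·(1+C·z²))·z + (1−C·z²)²)/(1−C·z²)² ∈ ℂ(z). Then D = 1 if and only if s₀ = 0 and s₁ = 0. -/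
noncomputable section

/-- A polynomial `1 - a X ^ 2` is nonzero as a rational function. -/
theorem RatFunc.one_sub_C_mul_X_sq_ne_zero {K : Type*} [Field K] (a : K) :
    (1 - RatFunc.C a * RatFunc.X ^ 2 : RatFunc K) ≠ 0 := by
  intro h
  have hp : algebraMap (Polynomial K) (RatFunc K)
      (1 - Polynomial.C a * Polynomial.X ^ 2) = 0 := by
    simpa [RatFunc.algebraMap_C, RatFunc.algebraMap_X] using h
  rw [map_eq_zero_iff _ (RatFunc.algebraMap_injective K)] at hp
  simpa using congrArg (fun p => Polynomial.eval 0 p) hp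

/-- If `a X + b (1 + c X ^ 2)` vanishes as a rational function, then `a = b = 0`. -/
theorem RatFunc.eq_zero_of_C_mul_X_add_eq_zero {K : Type*} [Field K] {a b c : K}
    (h : (RatFunc.C a * RatFunc.X + RatFunc.C b * (1 + RatFunc.C c * RatFunc.X ^ 2) :
      RatFunc K) = 0) : a = 0 ∧ b = 0 := by
  have hp : algebraMap (Polynomial K) (RatFunc K)
      (Polynomial.C a * Polynomial.X +
        Polynomial.C b * (1 + Polynomial.C c * Polynomial.X ^ 2)) = 0 := by
    simpa [RatFunc.algebraMap_C, RatFunc.algebraMap_X] using h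
  rw [map_eq_zero_iff _ (RatFunc.algebraMap_injective K)] at hp
  have hb : b = 0 := by simpa using congrArg (fun p => Polynomial.eval 0 p) hp
  subst hb
  exact ⟨by simpa using congrArg (fun p => Polynomial.eval 1 p) hp, rfl⟩

/-- Triviality criterion: the eigenvalue series `Đ_{c,s}(z)` of the normalized
Drinfeld–Cartan series on the one-dimensional representation `ℂ_{c,s}` equals `1`
if and only if `s₀ = s₁ = 0`. -/
theorem one_dimensional_eigenvalue_trivial_iff
    (q c₀ c₁ : ℂ) (hq : q ≠ 0) (hq2 : q ^ 2 ≠ 1)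
    (hc₀ : c₀ ≠ 0) (hc₁ : c₁ ≠ 0) (s₀ s₁ : ℂ)
    (C α β : ℂ)
    (hC : C = q ^ 4 * c₀ * c₁)
    (hα : α = C * ((q ^ 2)⁻¹ * c₀⁻¹ * s₀) ^ 2 + s₁ ^ 2)
    (hβ : β = (q ^ 2)⁻¹ * c₀⁻¹ * s₀ * s₁)
    (D : RatFunc ℂ)
    (hD : D = (RatFunc.C (q⁻¹ * (q - q⁻¹) ^ 2 * c₁⁻¹ * C) *
        (RatFunc.C α * RatFunc.X +
          RatFunc.C β * (1 + RatFunc.C C * RatFunc.X ^ 2)) * RatFunc.X +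
        (1 - RatFunc.C C * RatFunc.X ^ 2) ^ 2) /
      (1 - RatFunc.C C * RatFunc.X ^ 2) ^ 2) :
    D = 1 ↔ s₀ = 0 ∧ s₁ = 0 := by
  have hden := pow_ne_zero 2 (RatFunc.one_sub_C_mul_X_sq_ne_zero C)
  have hC0 : C ≠ 0 := by
    rw [hC]
    exact mul_ne_zero (mul_ne_zero (pow_ne_zero 4 hq) hc₀) hc₁
  have hqq : q - q⁻¹ ≠ 0 := by
    intro h
    apply hq2
    field_simp at h
    linear_combination h
  have hK : q⁻¹ * (q - q⁻¹) ^ 2 * c₁⁻¹ * C ≠ 0 :=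
    mul_ne_zero (mul_ne_zero (mul_ne_zero (inv_ne_zero hq) (pow_ne_zero 2 hqq))
      (inv_ne_zero hc₁)) hC0
  have hKC : RatFunc.C (q⁻¹ * (q - q⁻¹) ^ 2 * c₁⁻¹ * C) ≠ 0 :=
    (map_ne_zero RatFunc.C).mpr hK
  rw [hD, div_eq_one_iff_eq hden, add_eq_right]
  constructor
  · intro h
    obtain ⟨hα0, hβ0⟩ := RatFunc.eq_zero_of_C_mul_X_add_eq_zero
      ((mul_eq_zero.mp ((mul_eq_zero.mp h).resolve_right RatFunc.X_ne_zero)).resolve_left hKC)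
    rw [hα] at hα0
    rw [hβ] at hβ0
    have hs : s₀ = 0 ∨ s₁ = 0 := by simpa [hq, hc₀] using hβ0
    rcases hs with rfl | rfl
    · exact ⟨rfl, by simpa using hα0⟩
    · exact ⟨by simpa [hC0, hq, hc₀] using hα0, rfl⟩
  · rintro ⟨rfl, rfl⟩
    simp [hα, hβ]
end
end
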